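/- arXiv:2209.09679 — 5 statements merged into one kernel-verified Lean document; each statement's English description precedes it below -/
import Mathlib

section
/- Let C be a model category and let A and X be objects of C. Then: (1) if A is cofibrant, the left-homotopy relation ~ˡ is an equivalence relation on C(A, X); (2) if X is fibrant, the right-homotopy relation ~ʳ is an equivalence relation on C(A, X); (3) if A is cofibrant and X is fibrant, the relations ~ˡ and ~ʳ on C(A, X) coincide. -/
open CategoryTheory CategoryTheory.Limits

universe v u

variable {C : Type u} [Category.{v} C]

/-- `f` is a retract of `g` in the arrow category. -/
def IsRetractOfArrow {X Y X' Y' : C} (f : X ⟶ Y) (g : X' ⟶ Y') : Prop :=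
  ∃ (i : X ⟶ X') (p : X' ⟶ X) (j : Y ⟶ Y') (q : Y' ⟶ Y),
    i ≫ p = 𝟙 X ∧ j ≫ q = 𝟙 Y ∧ i ≫ g = f ≫ j ∧ g ≫ q = p ≫ f

/-- A model structure on a category: three classes of morphisms (cofibrations, weak
equivalences, fibrations) satisfying Quillen's axioms (MC1)-(MC5). -/
structure ModelStructure (C : Type u) [Category.{v} C] where
  cof : MorphismProperty C
  weq : MorphismProperty C
  fib : MorphismProperty C
  /-- (MC1) identities -/
  cof_id : ∀ X : C, cof (𝟙 X)
  weq_id : ∀ X : C, weq (𝟙 X)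
  fib_id : ∀ X : C, fib (𝟙 X)
  /-- (MC1) compositions -/
  cof_comp : ∀ {X Y Z : C} (f : X ⟶ Y) (g : Y ⟶ Z), cof f → cof g → cof (f ≫ g)
  weq_comp : ∀ {X Y Z : C} (f : X ⟶ Y) (g : Y ⟶ Z), weq f → weq g → weq (f ≫ g)
  fib_comp : ∀ {X Y Z : C} (f : X ⟶ Y) (g : Y ⟶ Z), fib f → fib g → fib (f ≫ g)
  /-- (MC2) retracts -/
  cof_retract : ∀ {X Y X' Y' : C} {f : X ⟶ Y} {g : X' ⟶ Y'},
    IsRetractOfArrow f g → cof g → cof f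
  weq_retract : ∀ {X Y X' Y' : C} {f : X ⟶ Y} {g : X' ⟶ Y'},
    IsRetractOfArrow f g → weq g → weq f
  fib_retract : ∀ {X Y X' Y' : C} {f : X ⟶ Y} {g : X' ⟶ Y'},
    IsRetractOfArrow f g → fib g → fib f
  /-- (MC3) two-out-of-three -/
  weq_of_post : ∀ {X Y Z : C} (f : X ⟶ Y) (g : Y ⟶ Z), weq f → weq (f ≫ g) → weq g
  weq_of_pre : ∀ {X Y Z : C} (f : X ⟶ Y) (g : Y ⟶ Z), weq g → weq (f ≫ g) → weq f
  /-- (MC4) lifting -/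
  lift_cof_trivFib : ∀ {A B X Y : C} (i : A ⟶ B) (p : X ⟶ Y),
    cof i → weq p → fib p → HasLiftingProperty i p
  lift_trivCof_fib : ∀ {A B X Y : C} (i : A ⟶ B) (p : X ⟶ Y),
    cof i → weq i → fib p → HasLiftingProperty i p
  /-- (MC5) factorizations -/
  factor_cof_trivFib : ∀ {X Y : C} (f : X ⟶ Y),
    ∃ (Z : C) (i : X ⟶ Z) (p : Z ⟶ Y), cof i ∧ weq p ∧ fib p ∧ i ≫ p = f
  factor_trivCof_fib : ∀ {X Y : C} (f : X ⟶ Y),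
    ∃ (Z : C) (j : X ⟶ Z) (q : Z ⟶ Y), cof j ∧ weq j ∧ fib q ∧ j ≫ q = f

/-- An object is cofibrant if the unique map from the initial object is a cofibration. -/
def ModelStructure.Cofibrant [HasInitial C] (M : ModelStructure C) (A : C) : Prop :=
  M.cof (initial.to A)

/-- An object is fibrant if the unique map to the terminal object is a fibration. -/
def ModelStructure.Fibrant [HasTerminal C] (M : ModelStructure C) (X : C) : Prop :=
  M.fib (terminal.from X)

/-- Two morphisms `f g : A ⟶ X` are left-homotopic if `f + g : A ⊔ A ⟶ X` factors through
some cylinder object for `A`, i.e. through a factorization of the codiagonal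
`A ⊔ A ⟶ A∧I ⟶ A` whose second map is a weak equivalence. -/
def ModelStructure.LeftHomotopic (M : ModelStructure C) {A X : C} (f g : A ⟶ X) : Prop :=
  ∃ (Cyl : C) (i₀ i₁ : A ⟶ Cyl) (w : Cyl ⟶ A),
    M.weq w ∧ i₀ ≫ w = 𝟙 A ∧ i₁ ≫ w = 𝟙 A ∧
    ∃ H : Cyl ⟶ X, i₀ ≫ H = f ∧ i₁ ≫ H = g

/-- Two morphisms `f g : A ⟶ X` are right-homotopic if `(f, g) : A ⟶ X × X` factors through
some path object for `X`, i.e. through a factorization of the diagonal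
`X ⟶ X^I ⟶ X × X` whose first map is a weak equivalence. -/
def ModelStructure.RightHomotopic (M : ModelStructure C) {A X : C} (f g : A ⟶ X) : Prop :=
  ∃ (P : C) (w : X ⟶ P) (p₀ p₁ : P ⟶ X),
    M.weq w ∧ w ≫ p₀ = 𝟙 X ∧ w ≫ p₁ = 𝟙 X ∧
    ∃ K : A ⟶ P, K ≫ p₀ = f ∧ K ≫ p₁ = g

open HomotopicalAlgebra in
/-- The Mathlib model category attached to a `ModelStructure`. -/
@[reducible]
noncomputable def ModelStructure.toModelCategory [HasFiniteLimits C] [HasFiniteColimits C]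
    (M : ModelStructure C) : ModelCategory C where
  categoryWithFibrations := ⟨M.fib⟩
  categoryWithCofibrations := ⟨M.cof⟩
  categoryWithWeakEquivalences := ⟨M.weq⟩
  cm2 :=
    { comp_mem := fun f g hf hg => M.weq_comp f g hf hg
      of_postcomp := fun f g hg hfg => M.weq_of_pre f g hg hfg
      of_precomp := fun f g hf hfg => M.weq_of_post f g hf hfg }
  cm3a := ⟨fun h hg => M.weq_retract
    ⟨h.i.left, h.r.left, h.i.right, h.r.right, h.retract_left, h.retract_right,
      h.i.w, h.r.w.symm⟩ hg⟩
  cm3b := ⟨fun h hg => M.fib_retract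
    ⟨h.i.left, h.r.left, h.i.right, h.r.right, h.retract_left, h.retract_right,
      h.i.w, h.r.w.symm⟩ hg⟩
  cm3c := ⟨fun h hg => M.cof_retract
    ⟨h.i.left, h.r.left, h.i.right, h.r.right, h.retract_left, h.retract_right,
      h.i.w, h.r.w.symm⟩ hg⟩
  cm4a := fun i p hi hw hp => M.lift_trivCof_fib i p hi.mem hw.mem hp.mem
  cm4b := fun i p hi hp hw => M.lift_cof_trivFib i p hi.mem hw.mem hp.mem
  cm5a := ⟨fun f => by
    obtain ⟨Z, j, q, h1, h2, h3, h4⟩ := M.factor_trivCof_fib f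
    exact ⟨{ Z := Z, i := j, p := q, fac := h4, hi := ⟨h1, h2⟩, hp := h3 }⟩⟩
  cm5b := ⟨fun f => by
    obtain ⟨Z, j, q, h1, h2, h3, h4⟩ := M.factor_cof_trivFib f
    exact ⟨{ Z := Z, i := j, p := q, fac := h4, hi := h1, hp := ⟨h3, h2⟩ }⟩⟩

open HomotopicalAlgebra in
lemma ModelStructure.leftHomotopic_iff [HasFiniteLimits C] [HasFiniteColimits C]
    (M : ModelStructure C) {A X : C} (f g : A ⟶ X) :
    letI := M.toModelCategory
    M.LeftHomotopic f g ↔ LeftHomotopyRel f g := by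
  letI := M.toModelCategory
  constructor
  · rintro ⟨I, i₀, i₁, w, hw, h₀, h₁, H, hf, hg⟩
    exact ⟨{ I := I, i₀ := i₀, i₁ := i₁, π := w, i₀_π := h₀, i₁_π := h₁,
             weakEquivalence_π := ⟨hw⟩ }, ⟨{ h := H, h₀ := hf, h₁ := hg }⟩⟩
  · rintro ⟨P, ⟨h⟩⟩
    exact ⟨P.I, P.i₀, P.i₁, P.π, P.weakEquivalence_π.mem, P.i₀_π, P.i₁_π, h.h, h.h₀, h.h₁⟩

open HomotopicalAlgebra in
lemma ModelStructure.rightHomotopic_iff [HasFiniteLimits C] [HasFiniteColimits C]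
    (M : ModelStructure C) {A X : C} (f g : A ⟶ X) :
    letI := M.toModelCategory
    M.RightHomotopic f g ↔ RightHomotopyRel f g := by
  letI := M.toModelCategory
  constructor
  · rintro ⟨I, w, p₀, p₁, hw, h₀, h₁, H, hf, hg⟩
    exact ⟨{ P := I, p₀ := p₀, p₁ := p₁, ι := w, ι_p₀ := h₀, ι_p₁ := h₁,
             weakEquivalence_ι := ⟨hw⟩ }, ⟨{ h := H, h₀ := hf, h₁ := hg }⟩⟩
  · rintro ⟨P, ⟨h⟩⟩
    exact ⟨P.P, P.ι, P.p₀, P.p₁, P.weakEquivalence_ι.mem, P.ι_p₀, P.ι_p₁, h.h, h.h₀, h.h₁⟩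

theorem stmt4 [HasFiniteLimits C] [HasFiniteColimits C] (M : ModelStructure C) (A X : C) :
    (M.Cofibrant A → Equivalence (fun f g : A ⟶ X => M.LeftHomotopic f g)) ∧
    (M.Fibrant X → Equivalence (fun f g : A ⟶ X => M.RightHomotopic f g)) ∧
    (M.Cofibrant A → M.Fibrant X →
      ∀ f g : A ⟶ X, M.LeftHomotopic f g ↔ M.RightHomotopic f g) := by
  letI := M.toModelCategory
  refine ⟨fun hA => ?_, fun hX => ?_, fun hA hX f g => ?_⟩
  · haveI : HomotopicalAlgebra.IsCofibrant A := ⟨hA⟩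
    simp only [M.leftHomotopic_iff]
    exact HomotopicalAlgebra.LeftHomotopyRel.equivalence A X
  · haveI : HomotopicalAlgebra.IsFibrant X := ⟨hX⟩
    simp only [M.rightHomotopic_iff]
    exact HomotopicalAlgebra.RightHomotopyRel.equivalence A X
  · haveI : HomotopicalAlgebra.IsCofibrant A := ⟨hA⟩
    haveI : HomotopicalAlgebra.IsFibrant X := ⟨hX⟩
    rw [M.leftHomotopic_iff, M.rightHomotopic_iff]
    exact HomotopicalAlgebra.leftHomotopyRel_iff_rightHomotopyRel
end

section
/- Let F : C ⥤ D and F' : C' ⥤ D' be functors such that F is a retract of F', i.e., there are functors i : C ⥤ C', p : C' ⥤ C, j : D ⥤ D', q : D' ⥤ D with p ∘ i = 1_C, q ∘ j = 1_D, F' ∘ i = j ∘ F and q ∘ F' = F ∘ p. If F' is an equivalence of categories, then so is F. -/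
open CategoryTheory

universe v₁ v₂ v₃ v₄ u₁ u₂ u₃ u₄

/-- A retract (in the arrow sense) of an equivalence of categories is an equivalence. -/
theorem stmt7 {C : Type u₁} {D : Type u₂} {C' : Type u₃} {D' : Type u₄}
    [Category.{v₁} C] [Category.{v₂} D] [Category.{v₃} C'] [Category.{v₄} D']
    (F : C ⥤ D) (F' : C' ⥤ D')
    (i : C ⥤ C') (p : C' ⥤ C) (j : D ⥤ D') (q : D' ⥤ D)
    (hpi : i ⋙ p = 𝟭 C) (hqj : j ⋙ q = 𝟭 D)
    (hsq₁ : i ⋙ F' = F ⋙ j) (hsq₂ : F' ⋙ q = p ⋙ F)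
    (hF' : F'.IsEquivalence) : F.IsEquivalence := by
  let e := F'.asEquivalence
  let G : D ⥤ C := j ⋙ e.inverse ⋙ p
  have η : 𝟭 C ≅ F ⋙ G :=
    (eqToIso hpi).symm ≪≫ Functor.isoWhiskerLeft i (Functor.leftUnitor p).symm ≪≫
      Functor.isoWhiskerLeft i (Functor.isoWhiskerRight e.unitIso p) ≪≫
      (show i ⋙ (F' ⋙ e.inverse) ⋙ p ≅ (i ⋙ F') ⋙ e.inverse ⋙ p from Iso.refl _) ≪≫
      Functor.isoWhiskerRight (eqToIso hsq₁) (e.inverse ⋙ p) ≪≫ Functor.associator _ _ _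
  have ε : G ⋙ F ≅ 𝟭 D :=
    (show G ⋙ F ≅ (j ⋙ e.inverse) ⋙ (p ⋙ F) from Iso.refl _) ≪≫
      Functor.isoWhiskerLeft (j ⋙ e.inverse) (eqToIso hsq₂.symm) ≪≫
      (show (j ⋙ e.inverse) ⋙ (F' ⋙ q) ≅ j ⋙ (e.inverse ⋙ F') ⋙ q from Iso.refl _) ≪≫
      Functor.isoWhiskerLeft j (Functor.isoWhiskerRight e.counitIso q) ≪≫
      Functor.isoWhiskerLeft j (Functor.leftUnitor q) ≪≫ eqToIso hqj
  exact (CategoryTheory.Equivalence.mk F G η ε).isEquivalence_functor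
end

section
/- Let F : C ⥤ D be a functor between small categories that is injective on objects and an equivalence of categories, and let G : M ⥤ N be an isofibration. Then F ⊥ G in the category Cat of small categories: every commutative square of functors i : C ⥤ M, j : D ⥤ N with G ∘ i = j ∘ F admits a functor H : D ⥤ M with H ∘ F = i and G ∘ H = j. -/
open CategoryTheory

universe u

/-- A functor `F : C ⥤ D` is an isofibration if every isomorphism `g : F(X) ⟶ Y` in `D` lifts
to an isomorphism `h : X ⟶ X'` in `C` with `F(h) = g` (in particular `F(X') = Y`). -/
def Isofibration {C : Type u₁} {D : Type u₂} [Category.{v₁} C] [Category.{v₂} D]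
    (F : C ⥤ D) : Prop :=
  ∀ ⦃X : C⦄ ⦃Y : D⦄ (g : F.obj X ⟶ Y), IsIso g →
    ∃ (X' : C) (h : X ⟶ X'), IsIso h ∧ ∃ e : F.obj X' = Y, F.map h = g ≫ eqToHom e.symm

/-- An acyclic injection is left orthogonal to any isofibration: every commutative square with
left edge an injective-on-objects equivalence `F` and right edge an isofibration `G` admits
a lifting. -/
theorem stmt11 {C D M N : Type u}
    [Category.{u} C] [Category.{u} D] [Category.{u} M] [Category.{u} N]
    (F : C ⥤ D) (G : M ⥤ N)
    (hFinj : Function.Injective F.obj) (hFequiv : F.IsEquivalence)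
    (hG : Isofibration G)
    (i : C ⥤ M) (j : D ⥤ N) (sq : i ⋙ G = F ⋙ j) :
    ∃ H : D ⥤ M, F ⋙ H = i ∧ H ⋙ G = j := by
  classical
  have hobj : ∀ c, G.obj (i.obj c) = j.obj (F.obj c) := fun c => Functor.congr_obj sq c
  have key : ∀ d : D, ∃ (c : C) (a : F.obj c ≅ d) (m : M) (k : i.obj c ≅ m)
      (e : G.obj m = j.obj d),
      G.map k.hom = eqToHom (hobj c) ≫ j.map a.hom ≫ eqToHom e.symm ∧
      ∀ c0 (h : F.obj c0 = d), ∃ (h1 : c = c0) (h2 : m = i.obj c0),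
        a.hom = eqToHom (by rw [h1, h]) ∧ k.hom = eqToHom (by rw [h1, h2]) := by
    intro d
    by_cases hd : ∃ c, F.obj c = d
    · obtain ⟨c, rfl⟩ := hd
      refine ⟨c, Iso.refl _, i.obj c, Iso.refl _, hobj c, by simp, ?_⟩
      intro c0 h
      obtain rfl := hFinj h
      exact ⟨rfl, rfl, by simp, by simp⟩
    · let c := F.objPreimage d
      let a : F.obj c ≅ d := F.objObjPreimageIso d
      obtain ⟨m, k, hk, e, he⟩ := hG (X := i.obj c) (eqToHom (hobj c) ≫ j.map a.hom) inferInstance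
      exact ⟨c, a, m, asIso k, e, by simpa using he, fun c0 h => absurd ⟨c0, h⟩ hd⟩
  choose c a m k e hk hc using key
  let H : D ⥤ M :=
    { obj := m
      map := fun {x y} f => (k x).inv ≫ i.map (F.preimage ((a x).hom ≫ f ≫ (a y).inv)) ≫ (k y).hom
      map_id := by
        intro x
        have : F.preimage ((a x).hom ≫ 𝟙 x ≫ (a x).inv) = 𝟙 _ := F.map_injective (by simp)
        rw [this]; simp
      map_comp := by
        intro x y z f g
        have : F.preimage ((a x).hom ≫ (f ≫ g) ≫ (a z).inv) =
            F.preimage ((a x).hom ≫ f ≫ (a y).inv) ≫ F.preimage ((a y).hom ≫ g ≫ (a z).inv) :=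
          F.map_injective (by simp)
        rw [this]; simp }
  refine ⟨H, ?_, ?_⟩
  · have hm : ∀ x, m (F.obj x) = i.obj x := fun x => (hc _ x rfl).2.1
    refine CategoryTheory.Functor.ext hm ?_
    intro x y f
    obtain ⟨hx1, hx2, hx3, hx4⟩ := hc _ x rfl
    obtain ⟨hy1, hy2, hy3, hy4⟩ := hc _ y rfl
    have h1 : F.preimage ((a (F.obj x)).hom ≫ F.map f ≫ (a (F.obj y)).inv) =
        eqToHom hx1 ≫ f ≫ eqToHom hy1.symm := by
      apply F.map_injective
      have : (a (F.obj y)).inv = eqToHom (by rw [hy1]) := by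
        rw [← cancel_epi (a (F.obj y)).hom, Iso.hom_inv_id, hy3]; simp
      rw [this, hx3]
      simp [eqToHom_map]
    have h2 : (k (F.obj x)).inv = eqToHom (by rw [hx1, hx2]) := by
      rw [← cancel_epi (k (F.obj x)).hom, Iso.hom_inv_id, hx4]; simp
    change (k (F.obj x)).inv ≫ i.map (F.preimage ((a (F.obj x)).hom ≫ F.map f ≫ (a (F.obj y)).inv))
      ≫ (k (F.obj y)).hom = _
    rw [h1, h2, hy4]
    simp [eqToHom_map]
  · refine CategoryTheory.Functor.ext (fun x => e x) ?_
    intro x y f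
    have hinv : G.map (k x).inv = eqToHom (e x) ≫ j.map (a x).inv ≫ eqToHom (hobj _).symm := by
      rw [← cancel_epi (G.map (k x).hom), ← G.map_comp, Iso.hom_inv_id, hk]
      simp [← Functor.map_comp_assoc]
    have hs := Functor.congr_hom sq (F.preimage ((a x).hom ≫ f ≫ (a y).inv))
    simp only [Functor.comp_map, Functor.map_preimage] at hs
    change G.map ((k x).inv ≫ i.map (F.preimage ((a x).hom ≫ f ≫ (a y).inv)) ≫ (k y).hom) = _
    rw [G.map_comp, G.map_comp, hs, hinv, hk]
    simp
end

section
/- Let F : C ⥤ D be a functor between small categories that is injective on objects, and let G : M ⥤ N be a functor that is fully faithful and surjective on objects (an acyclic isofibration). Then F ⊥ G in the category Cat of small categories: every commutative square of functors i : C ⥤ M, j : D ⥤ N with G ∘ i = j ∘ F admits a functor H : D ⥤ M with H ∘ F = i and G ∘ H = j. -/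
open CategoryTheory

universe u

/-- An injection is left orthogonal to any acyclic isofibration: every commutative square with
left edge an injective-on-objects functor `F` and right edge a functor `G` which is fully
faithful and surjective on objects admits a lifting. -/
theorem stmt12 {C D M N : Type u}
    [Category.{u} C] [Category.{u} D] [Category.{u} M] [Category.{u} N]
    (F : C ⥤ D) (G : M ⥤ N)
    (hFinj : Function.Injective F.obj)
    (hGfull : G.Full) (hGfaithful : G.Faithful) (hGsurj : Function.Surjective G.obj)
    (i : C ⥤ M) (j : D ⥤ N) (sq : i ⋙ G = F ⋙ j) :
    ∃ H : D ⥤ M, F ⋙ H = i ∧ H ⋙ G = j := by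
  classical
  have hex : ∀ d : D, ∃ m : M, G.obj m = j.obj d ∧ ∀ c : C, F.obj c = d → m = i.obj c := by
    intro d
    by_cases h : ∃ c, F.obj c = d
    · obtain ⟨c, rfl⟩ := h
      refine ⟨i.obj c, Functor.congr_obj sq c, ?_⟩
      intro c' hc'
      rw [hFinj hc']
    · obtain ⟨m, hm⟩ := hGsurj (j.obj d)
      exact ⟨m, hm, fun c hc => absurd ⟨c, hc⟩ h⟩
  choose o ho hoi using hex
  let H : D ⥤ M :=
    { obj := o
      map := fun {X Y} f => G.preimage (eqToHom (ho X) ≫ j.map f ≫ eqToHom (ho Y).symm)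
      map_id := fun X => G.map_injective (by simp)
      map_comp := fun f g => G.map_injective (by simp) }
  refine ⟨H, ?_, ?_⟩
  · refine CategoryTheory.Functor.ext (fun c => hoi _ c rfl) ?_
    intro X Y f
    apply G.map_injective
    have h := Functor.congr_hom sq f
    simp only [Functor.comp_map] at h
    simp [H, eqToHom_map, h]
  · refine CategoryTheory.Functor.ext (fun d => ho d) ?_
    intro X Y f
    simp [H]
end

section
/- Every functor F : C ⥤ D between small categories admits a factorization F = q ∘ ι where ι : C ⥤ C' is injective on objects and an equivalence of categories, and q : C' ⥤ D is an isofibration. -/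
open CategoryTheory

universe u

/-- Objects of the path category of `F`: triples `(X, Y, F X ≅ Y)`. -/
structure PathObj {C D : Type u} [Category.{u} C] [Category.{u} D] (F : C ⥤ D) : Type u where
  fst : C
  snd : D
  iso : F.obj fst ≅ snd

/-- Morphisms are those between the first components. -/
instance pathCategory {C D : Type u} [Category.{u} C] [Category.{u} D] (F : C ⥤ D) :
    Category.{u} (PathObj F) where
  Hom A B := A.fst ⟶ B.fst
  id A := 𝟙 A.fst
  comp f g := CategoryStruct.comp (obj := C) f g
  id_comp f := Category.id_comp (obj := C) f
  comp_id f := Category.comp_id (obj := C) f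
  assoc f g h := Category.assoc (obj := C) f g h

/-- The inclusion. -/
def pathIncl {C D : Type u} [Category.{u} C] [Category.{u} D] (F : C ⥤ D) : C ⥤ PathObj F where
  obj X := ⟨X, F.obj X, Iso.refl _⟩
  map f := f
  map_id _ := rfl
  map_comp _ _ := rfl

/-- The first projection, quasi-inverse to the inclusion. -/
def pathFst {C D : Type u} [Category.{u} C] [Category.{u} D] (F : C ⥤ D) : PathObj F ⥤ C where
  obj A := A.fst
  map f := f
  map_id _ := rfl
  map_comp _ _ := rfl

/-- The second projection. -/
def pathSnd {C D : Type u} [Category.{u} C] [Category.{u} D] (F : C ⥤ D) : PathObj F ⥤ D where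
  obj A := A.snd
  map {A B} f := A.iso.inv ≫ F.map ((pathFst F).map f) ≫ B.iso.hom
  map_id A := by
    change A.iso.inv ≫ F.map (𝟙 A.fst) ≫ A.iso.hom = 𝟙 A.snd
    simp
  map_comp {P Q R} f g := by
    have key : ∀ (a : P.fst ⟶ Q.fst) (b : Q.fst ⟶ R.fst),
        P.iso.inv ≫ F.map (a ≫ b) ≫ R.iso.hom =
          (P.iso.inv ≫ F.map a ≫ Q.iso.hom) ≫ Q.iso.inv ≫ F.map b ≫ R.iso.hom := by
      intro a b
      simp
    exact key f g

/-- Every functor between small categories factors as an injective-on-objects equivalence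
(an acyclic injection) followed by an isofibration. -/
theorem stmt14 {C D : Type u} [Category.{u} C] [Category.{u} D] (F : C ⥤ D) :
    ∃ (E : Cat.{u, u}) (ι : C ⥤ E) (q : E ⥤ D),
      Function.Injective ι.obj ∧ ι.IsEquivalence ∧
      Isofibration q ∧
      ι ⋙ q = F := by
  refine ⟨Cat.of (PathObj F), pathIncl F, pathSnd F, ?_, ?_, ?_, ?_⟩
  · intro X Y h
    exact congrArg PathObj.fst h
  · have hff : (pathIncl F).FullyFaithful :=
      { preimage := fun f => (pathFst F).map f
        map_preimage := fun _ => rfl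
        preimage_map := fun _ => rfl }
    have h1 := hff.full
    have h2 := hff.faithful
    have h3 : (pathIncl F).EssSurj :=
      ⟨fun A => ⟨A.fst, ⟨{ hom := 𝟙 A.fst
                           inv := 𝟙 A.fst
                           hom_inv_id := Category.id_comp (obj := C) _
                           inv_hom_id := Category.id_comp (obj := C) _ }⟩⟩⟩
    exact { faithful := h2, full := h1, essSurj := h3 }
  · intro A Y g hg
    let A : PathObj F := A
    change A.snd ⟶ Y at g
    let B : PathObj F := ⟨A.fst, Y, A.iso ≪≫ @asIso _ _ _ _ g hg⟩
    let i : A ≅ B :=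
      { hom := 𝟙 A.fst
        inv := 𝟙 A.fst
        hom_inv_id := Category.id_comp (obj := C) _
        inv_hom_id := Category.id_comp (obj := C) _ }
    refine ⟨B, i.hom, i.isIso_hom, rfl, ?_⟩
    change A.iso.inv ≫ F.map (𝟙 A.fst) ≫ A.iso.hom ≫ g = g ≫ 𝟙 Y
    simp
  · refine CategoryTheory.Functor.ext (fun _ => rfl) (fun X Y f => ?_)
    change 𝟙 (F.obj X) ≫ F.map f ≫ 𝟙 (F.obj Y) = 𝟙 (F.obj X) ≫ F.map f ≫ 𝟙 (F.obj Y)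
    rfl
end
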